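/- Fix an integer η ≥ 1 and a real β > 0. The function σ ↦ F(β,σ) is strictly increasing on (0,∞), with F(β,σ) → 0 as σ ↓ 0 and F(β,σ) → ∞ as σ → ∞; hence there is a unique σ(β) > 0 with F(β,σ(β)) = 1. Moreover, the map β ↦ σ(β) is strictly increasing on [η−1, η+1] (on (0, η+1] when η = 1). -/

import Mathlib

/-- `F(β,σ) = (η + 2 + β/(1+μ₀+βμ₀))·ln(1+μ₀)` where `μ₀ = m β σ = μ₀(β,σ)` is the unique
positive solution of `μ(1+μ)^β = σ`. -/
noncomputable def Ffun (η : ℕ) (m : ℝ → ℝ → ℝ) (β σ : ℝ) : ℝ :=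
  ((η : ℝ) + 2 + β / (1 + m β σ + β * m β σ)) * Real.log (1 + m β σ)

/-- The value of `F` in terms of `μ = μ₀(β,σ)`. -/
noncomputable def levelFun (A β x : ℝ) : ℝ :=
  (A + β / (1 + x + β * x)) * Real.log (1 + x)

lemma sq_log_one_add_mul_le {x : ℝ} (hx : 0 < x) :
    Real.log (1 + x) ^ 2 * (1 + x) ≤ x ^ 2 := by
  have h1 : 0 < 1 + x := by linarith
  have hL : 0 < Real.log (1 + x) := Real.log_pos (by linarith)
  have hs : Real.log (1 + x) / 2 ≤ Real.sinh (Real.log (1 + x) / 2) :=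
    Real.self_le_sinh_iff.2 (by positivity)
  have hc : Real.cosh (Real.log (1 + x)) = 1 + 2 * Real.sinh (Real.log (1 + x) / 2) ^ 2 := by
    have h := Real.cosh_two_mul (Real.log (1 + x) / 2)
    rw [mul_div_cancel₀ _ (two_ne_zero' ℝ), Real.cosh_sq] at h
    linarith
  rw [Real.cosh_log h1] at hc
  have hsq := pow_le_pow_left₀ (by positivity) hs 2
  have hmul : (1 + x) * (1 + x)⁻¹ = 1 := mul_inv_cancel₀ h1.ne'
  have : Real.log (1 + x) ^ 2 ≤ 1 + x + (1 + x)⁻¹ - 2 := by nlinarith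
  nlinarith [mul_le_mul_of_nonneg_right this h1.le]

lemma log_one_add_mul_le {x : ℝ} (hx : 0 < x) :
    Real.log (1 + x) * (1 + x) ≤ x * (1 + x / 2) := by
  have h := mul_le_mul_of_nonneg_right (sq_log_one_add_mul_le hx) (by linarith : 0 ≤ 1 + x)
  refine le_of_sq_le_sq ?_ (by positivity)
  nlinarith [sq_nonneg (x ^ 2)]

lemma levelFun_lt_of_lt_left {A β γ x : ℝ} (hβ : 0 ≤ β) (h : β < γ) (hx : 0 < x) :
    levelFun A β x < levelFun A γ x := by
  have hL : 0 < Real.log (1 + x) := Real.log_pos (by linarith)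
  have hγ : 0 < γ := hβ.trans_lt h
  refine mul_lt_mul_of_pos_right (add_lt_add_right ?_ A) hL
  rw [div_lt_div_iff₀ (by positivity) (by positivity)]
  nlinarith

lemma continuousOn_levelFun {A β : ℝ} (hβ : 0 ≤ β) :
    ContinuousOn (levelFun A β) (Set.Ici 0) := by
  unfold levelFun
  have h1 (x : ℝ) (hx : x ∈ Set.Ici (0 : ℝ)) : 1 + x ≠ 0 := by
    have := Set.mem_Ici.1 hx
    positivity
  have h2 (x : ℝ) (hx : x ∈ Set.Ici (0 : ℝ)) : 1 + x + β * x ≠ 0 := by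
    have := Set.mem_Ici.1 hx
    positivity
  exact (continuousOn_const.add (continuousOn_const.div (by fun_prop) h2)).mul
    (ContinuousOn.log (by fun_prop) h1)

lemma strictMonoOn_levelFun {A β : ℝ} (hA : 1 ≤ A) (hβ : 0 ≤ β) :
    StrictMonoOn (levelFun A β) (Set.Ici 0) := by
  refine strictMonoOn_of_deriv_pos (convex_Ici 0) (continuousOn_levelFun hβ) fun x hx => ?_
  rw [interior_Ici, Set.mem_Ioi] at hx
  have h1 : 0 < 1 + x := by linarith
  have hD : 0 < 1 + x + β * x := by positivity
  have hd : HasDerivAt (levelFun A β)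
      ((0 * (1 + x + β * x) - β * (1 + β * 1)) / (1 + x + β * x) ^ 2 * Real.log (1 + x) +
        (A + β / (1 + x + β * x)) * (1 / (1 + x))) x := by
    have hlin := ((hasDerivAt_id x).const_add 1).add ((hasDerivAt_id x).const_mul β)
    exact (((hasDerivAt_const x β).div hlin hD.ne').const_add A).mul
      (((hasDerivAt_id x).const_add 1).log h1.ne')
  rw [hd.deriv]
  have hlog := Real.log_le_sub_one_of_pos h1
  have key : β * (1 + β) * (Real.log (1 + x) * (1 + x)) <
      A * (1 + x + β * x) ^ 2 + β * (1 + x + β * x) := by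
    have e1 : β * (1 + β) * (Real.log (1 + x) * (1 + x)) ≤ β * (1 + β) * (x * (1 + x)) := by
      gcongr
      linarith
    have e2 : (1 + x + β * x) ^ 2 ≤ A * (1 + x + β * x) ^ 2 :=
      le_mul_of_one_le_left (by positivity) hA
    have : 0 ≤ β * x := by positivity
    have : 0 ≤ β * x ^ 2 := by positivity
    nlinarith
  have : (0 * (1 + x + β * x) - β * (1 + β * 1)) / (1 + x + β * x) ^ 2 * Real.log (1 + x) +
        (A + β / (1 + x + β * x)) * (1 / (1 + x)) =
      (A * (1 + x + β * x) ^ 2 + β * (1 + x + β * x) -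
        β * (1 + β) * (Real.log (1 + x) * (1 + x))) / ((1 + x + β * x) ^ 2 * (1 + x)) := by
    field_simp
    ring
  rw [this]
  exact div_pos (sub_pos.2 key) (by positivity)

lemma mul_log_one_add_le_levelFun {A β x : ℝ} (hβ : 0 ≤ β) (hx : 0 ≤ x) :
    A * Real.log (1 + x) ≤ levelFun A β x := by
  have hL : 0 ≤ Real.log (1 + x) := Real.log_nonneg (by linarith)
  exact mul_le_mul_of_nonneg_right (le_add_of_nonneg_right (by positivity)) hL

lemma strictMonoOn_mul_one_add_rpow {β : ℝ} (hβ : 0 ≤ β) :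
    StrictMonoOn (fun x : ℝ => x * (1 + x) ^ β) (Set.Ici 0) := by
  intro x hx y hy hxy
  rw [Set.mem_Ici] at hx hy
  have h : (1 + x) ^ β ≤ (1 + y) ^ β := Real.rpow_le_rpow (by linarith) (by linarith) hβ
  exact mul_lt_mul hxy h (Real.rpow_pos_of_pos (by linarith) β) hy

/-- The solution `β` of `levelFun A β x = 1`. -/
noncomputable def levelParam (A x : ℝ) : ℝ :=
  (1 / Real.log (1 + x) - A) * (1 + x) / (1 - (1 / Real.log (1 + x) - A) * x)

lemma one_sub_mul_pos {A x : ℝ} (hA : 1 ≤ A) (hx : 0 < x) :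
    0 < 1 - (1 / Real.log (1 + x) - A) * x := by
  have hL : 0 < Real.log (1 + x) := Real.log_pos (by linarith)
  have h := Real.le_log_one_add_of_nonneg hx.le
  rw [div_le_iff₀ (by linarith)] at h
  have : 1 / Real.log (1 + x) * x ≤ 1 + x / 2 := by
    rw [one_div, inv_mul_le_iff₀ hL]
    linarith
  nlinarith

lemma eq_levelParam {A β x : ℝ} (hA : 1 ≤ A) (hβ : 0 ≤ β) (hx : 0 < x)
    (h : levelFun A β x = 1) : β = levelParam A x := by
  have hL : 0 < Real.log (1 + x) := Real.log_pos (by linarith)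
  have hD : 0 < 1 + x + β * x := by positivity
  have hc : 1 / Real.log (1 + x) - A = β / (1 + x + β * x) := by
    rw [sub_eq_iff_eq_add', div_eq_iff hL.ne']
    exact h.symm
  have hpos := one_sub_mul_pos hA hx
  rw [levelParam, eq_div_iff hpos.ne', hc]
  field_simp
  ring

/-- Along the curve `levelFun A β x = 1`, the quantity `ln (x (1 + x) ^ β)` decreases in `x`. -/
lemma deriv_log_add_levelParam_mul_log_neg {A x : ℝ} (hA : 1 ≤ A) (hx : 0 < x)
    (hAx : A * Real.log (1 + x) ≤ 1) :
    ∃ d < 0, HasDerivAt (fun y => Real.log y + levelParam A y * Real.log (1 + y)) d x := by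
  have h1 : 0 < 1 + x := by linarith
  have hL : 0 < Real.log (1 + x) := Real.log_pos (by linarith)
  have hpos := one_sub_mul_pos hA hx
  have hlog : HasDerivAt (fun y : ℝ => Real.log (1 + y)) (1 / (1 + x)) x :=
    ((hasDerivAt_id x).const_add 1).log h1.ne'
  have hcd : HasDerivAt (fun y => 1 / Real.log (1 + y) - A)
      ((0 * Real.log (1 + x) - 1 * (1 / (1 + x))) / Real.log (1 + x) ^ 2) x :=
    ((hasDerivAt_const x (1 : ℝ)).div hlog hL.ne').sub_const A
  have hparam := (hcd.mul ((hasDerivAt_id x).const_add 1)).div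
    ((hcd.mul (hasDerivAt_id x)).const_sub 1) hpos.ne'
  refine ⟨_, ?_, (Real.hasDerivAt_log hx.ne').add (hparam.mul hlog)⟩
  have hb : 0 ≤ levelParam A x := by
    have : 0 ≤ 1 / Real.log (1 + x) - A := by
      rw [sub_nonneg, le_div_iff₀ hL]
      exact hAx
    exact div_nonneg (by positivity) hpos.le
  have hl2 := sq_log_one_add_mul_le hx
  have hl1 := log_one_add_mul_le hx
  have hbdef : levelParam A x * (1 - (1 / Real.log (1 + x) - A) * x) =
      (1 / Real.log (1 + x) - A) * (1 + x) := div_mul_cancel₀ _ hpos.ne'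
  simp only [id, Pi.mul_apply]
  change x⁻¹ + (_ * Real.log (1 + x) + levelParam A x * (1 / (1 + x))) < 0
  generalize levelParam A x = b at *
  generalize Real.log (1 + x) = L at *
  have hD : 0 < 1 + x + b * x := by positivity
  obtain ⟨c, hc⟩ : ∃ c, c = 1 / L - A := ⟨_, rfl⟩
  rw [← hc] at hbdef hpos ⊢
  have hcb : c = b / (1 + x + b * x) := by
    rw [eq_div_iff hD.ne']
    linarith
  have hq : 1 - c * x = (1 + x) / (1 + x + b * x) := by
    rw [hcb]
    field_simp
    ring
  have key : b * (1 + b) * x * (L ^ 2 * (1 + x)) + (1 + x + b * x) * (L * (1 + x)) <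
      x * (1 + x + b * x) ^ 2 := by
    have e1 := mul_le_mul_of_nonneg_left hl2 (by positivity : 0 ≤ b * (1 + b) * x)
    have e2 := mul_le_mul_of_nonneg_left hl1 hD.le
    have : 0 < x ^ 2 := by positivity
    have : 0 < x ^ 3 := by positivity
    have : 0 ≤ b * x ^ 2 := by positivity
    have : 0 ≤ b * x ^ 3 := by positivity
    nlinarith
  rw [hq, hcb]
  have heq (u : ℝ) (hu : u = (b * (1 + b) * x * (L ^ 2 * (1 + x)) +
      (1 + x + b * x) * (L * (1 + x)) - x * (1 + x + b * x) ^ 2) / (L * x * (1 + x) ^ 2)) :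
      u < 0 := by
    rw [hu]
    exact div_neg_of_neg_of_pos (sub_neg.2 key) (by positivity)
  apply heq
  field_simp
  ring

lemma mul_one_add_rpow_lt_of_levelFun_eq_one {A β γ x y : ℝ} (hA : 1 ≤ A) (hβ : 0 < β)
    (hβγ : β < γ) (hx : 0 < x) (hy : 0 < y) (hβx : levelFun A β x = 1)
    (hγy : levelFun A γ y = 1) : x * (1 + x) ^ β < y * (1 + y) ^ γ := by
  have hyx : y < x := by
    by_contra! hxy
    have h1 := (strictMonoOn_levelFun hA hβ.le).monotoneOn hx.le hy.le hxy
    have h2 := levelFun_lt_of_lt_left (A := A) hβ.le hβγ hy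
    linarith
  have hderiv (z : ℝ) (hz : z ∈ Set.Icc y x) : ∃ d < 0,
      HasDerivAt (fun t => Real.log t + levelParam A t * Real.log (1 + t)) d z := by
    have hz0 : 0 < z := hy.trans_le hz.1
    refine deriv_log_add_levelParam_mul_log_neg hA hz0 ?_
    calc A * Real.log (1 + z) ≤ A * Real.log (1 + x) := by
          gcongr
          exact hz.2
      _ ≤ levelFun A β x := mul_log_one_add_le_levelFun hβ.le hx.le
      _ = 1 := hβx
  have hanti : StrictAntiOn (fun t => Real.log t + levelParam A t * Real.log (1 + t))
      (Set.Icc y x) := by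
    refine strictAntiOn_of_deriv_neg (convex_Icc y x) (fun z hz => ?_) fun z hz => ?_
    · obtain ⟨d, -, hd⟩ := hderiv z hz
      exact hd.continuousAt.continuousWithinAt
    · obtain ⟨d, hd0, hd⟩ := hderiv z (interior_subset hz)
      rwa [hd.deriv]
  have h := hanti (Set.left_mem_Icc.2 hyx.le) (Set.right_mem_Icc.2 hyx.le) hyx
  simp only [← eq_levelParam hA hβ.le hx hβx, ← eq_levelParam hA (hβ.trans hβγ).le hy hγy] at h
  have hlog (δ t : ℝ) (ht : 0 < t) :
      Real.log (t * (1 + t) ^ δ) = Real.log t + δ * Real.log (1 + t) := by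
    rw [Real.log_mul ht.ne' (by positivity), Real.log_rpow (by linarith)]
  rw [← hlog β x hx, ← hlog γ y hy] at h
  exact (Real.log_lt_log_iff (by positivity) (by positivity)).1 h

/-- For fixed `β > 0`, `σ ↦ F(β,σ)` is strictly increasing on `(0,∞)`, tends to `0` as
`σ ↓ 0` and to `∞` as `σ → ∞`; hence there is a unique `σ(β) > 0` with `F(β,σ(β)) = 1`.
Moreover `β ↦ σ(β)` is strictly increasing on `[η−1, η+1]` (on `(0, η+1]` when `η = 1`). -/
theorem F_monotone_and_sigma_of_beta (η : ℕ) (hη : 1 ≤ η) (m : ℝ → ℝ → ℝ)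
    (hm : ∀ β σ : ℝ, 0 ≤ β → 0 < σ →
      0 < m β σ ∧ m β σ * (1 + m β σ) ^ β = σ) :
    (∀ β : ℝ, 0 < β →
      StrictMonoOn (fun σ => Ffun η m β σ) (Set.Ioi 0) ∧
      Filter.Tendsto (fun σ => Ffun η m β σ) (nhdsWithin 0 (Set.Ioi 0)) (nhds 0) ∧
      Filter.Tendsto (fun σ => Ffun η m β σ) Filter.atTop Filter.atTop ∧
      (∃! σ : ℝ, 0 < σ ∧ Ffun η m β σ = 1)) ∧
    ∀ s : ℝ → ℝ, (∀ β : ℝ, 0 < β → 0 < s β ∧ Ffun η m β (s β) = 1) →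
      (2 ≤ η → StrictMonoOn s (Set.Icc ((η : ℝ) - 1) ((η : ℝ) + 1))) ∧
      (η = 1 → StrictMonoOn s (Set.Ioc 0 ((η : ℝ) + 1))) := by
  have hA : (1 : ℝ) ≤ (η : ℝ) + 2 := by
    have : (0 : ℝ) ≤ η := η.cast_nonneg
    linarith
  have hF (β σ : ℝ) : Ffun η m β σ = levelFun ((η : ℝ) + 2) β (m β σ) := rfl
  have hmlt (β x σ : ℝ) (hβ : 0 ≤ β) (hσ : 0 < σ) (hx : 0 ≤ x) (h : x * (1 + x) ^ β < σ) :
      x < m β σ := by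
    obtain ⟨h0, h1⟩ := hm β σ hβ hσ
    rw [← h1] at h
    exact ((strictMonoOn_mul_one_add_rpow hβ).lt_iff_lt hx h0.le).1 h
  have hmono (β : ℝ) (hβ : 0 < β) : StrictMonoOn (fun σ => Ffun η m β σ) (Set.Ioi 0) := by
    intro σ hσ τ hτ h
    obtain ⟨h0, h1⟩ := hm β σ hβ.le hσ
    exact strictMonoOn_levelFun hA hβ.le h0.le (hm β τ hβ.le hτ).1.le
      (hmlt β _ τ hβ.le hτ h0.le (h1.trans_lt h))
  refine ⟨fun β hβ => ⟨hmono β hβ, ?_, ?_, ?_⟩, fun s hs => ?_⟩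
  · have hzero : levelFun ((η : ℝ) + 2) β 0 = 0 := by simp [levelFun]
    have hcont := continuousOn_levelFun (A := (η : ℝ) + 2) hβ.le 0 Set.self_mem_Ici
    rw [ContinuousWithinAt, hzero] at hcont
    refine hcont.comp (tendsto_nhdsWithin_iff.2 ⟨?_, ?_⟩)
    · refine tendsto_of_tendsto_of_tendsto_of_le_of_le' tendsto_const_nhds
        (tendsto_nhdsWithin_of_tendsto_nhds Filter.tendsto_id) ?_ ?_ <;>
        filter_upwards [self_mem_nhdsWithin] with σ hσ
      · exact (hm β σ hβ.le hσ).1.le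
      · obtain ⟨h0, h1⟩ := hm β σ hβ.le hσ
        calc m β σ ≤ m β σ * (1 + m β σ) ^ β :=
              le_mul_of_one_le_right h0.le (Real.one_le_rpow (by linarith) hβ.le)
          _ = σ := h1
    · filter_upwards [self_mem_nhdsWithin] with σ hσ
      exact (hm β σ hβ.le hσ).1.le
  · have hm_top : Filter.Tendsto (m β) Filter.atTop Filter.atTop := by
      refine Filter.tendsto_atTop.2 fun M => ?_
      filter_upwards [Filter.eventually_gt_atTop (max M 0 * (1 + max M 0) ^ β)] with σ hσ
      have h0 : 0 ≤ max M 0 * (1 + max M 0) ^ β := by positivity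
      exact (le_max_left M 0).trans
        (hmlt β _ σ hβ.le (h0.trans_lt hσ) (le_max_right M 0) hσ).le
    have hlog_top : Filter.Tendsto (fun σ => Real.log (1 + m β σ)) Filter.atTop Filter.atTop :=
      Real.tendsto_log_atTop.comp (Filter.tendsto_atTop_add_const_left _ 1 hm_top)
    refine Filter.tendsto_atTop_mono' _ ?_
      (hlog_top.const_mul_atTop (zero_lt_one.trans_le hA))
    filter_upwards [Filter.eventually_gt_atTop 0] with σ hσ
    exact mul_log_one_add_le_levelFun hβ.le (hm β σ hβ.le hσ).1.le
  · obtain ⟨x, hx, hx1⟩ : ∃ x, 0 < x ∧ levelFun ((η : ℝ) + 2) β x = 1 := by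
      have he : (0 : ℝ) ≤ Real.exp 1 - 1 := by
        linarith [Real.add_one_le_exp (1 : ℝ)]
      have hzero : levelFun ((η : ℝ) + 2) β 0 = 0 := by simp [levelFun]
      have hge : 1 ≤ levelFun ((η : ℝ) + 2) β (Real.exp 1 - 1) := by
        refine le_trans ?_ (mul_log_one_add_le_levelFun hβ.le he)
        rwa [add_sub_cancel, Real.log_exp, mul_one]
      obtain ⟨x, hx, hx1⟩ := intermediate_value_Icc he
        ((continuousOn_levelFun (A := (η : ℝ) + 2) hβ.le).mono Set.Icc_subset_Ici_self)
        ⟨hzero.trans_le zero_le_one, hge⟩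
      refine ⟨x, hx.1.lt_of_ne ?_, hx1⟩
      rintro rfl
      linarith
    have hσ : 0 < x * (1 + x) ^ β := by positivity
    obtain ⟨h0, h1⟩ := hm β _ hβ.le hσ
    have hmx := (strictMonoOn_mul_one_add_rpow hβ.le).injOn h0.le hx.le h1
    have hFx : Ffun η m β (x * (1 + x) ^ β) = 1 := by rw [hF, hmx, hx1]
    exact ⟨_, ⟨hσ, hFx⟩, fun τ hτ => (hmono β hβ).injOn hτ.1 hσ (hτ.2.trans hFx.symm)⟩
  · have hs_mono : StrictMonoOn s (Set.Ioi 0) := by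
      intro β hβ γ hγ h
      rw [Set.mem_Ioi] at hβ hγ
      obtain ⟨hβs, hβF⟩ := hs β hβ
      obtain ⟨hγs, hγF⟩ := hs γ hγ
      obtain ⟨hx, hxs⟩ := hm β _ hβ.le hβs
      obtain ⟨hy, hys⟩ := hm γ _ hγ.le hγs
      rw [← hxs, ← hys]
      exact mul_one_add_rpow_lt_of_levelFun_eq_one hA hβ h hx hy hβF hγF
    refine ⟨fun h2 => hs_mono.mono fun β hβ => ?_, fun _ => hs_mono.mono fun β hβ => hβ.1⟩
    have : (2 : ℝ) ≤ η := by exact_mod_cast h2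
    rw [Set.mem_Ioi]
    linarith [hβ.1]
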